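/- Let M be a matroid of rank r on a ground set of size n, and let C and C' be distinct circuits of M with |C| = r + 1 and |C'| = r + 1 - d where 0 ≤ d < r + 1. Then β_C ≤ β_{C'}, with equality if and only if d = 0. In particular, there can be no monotonicity violation involving a circuit of maximum size r + 1. -/

import Mathlib

open Finset

/-- A matroid presented by its collection of circuits (the valid sets of bingo
cards): nonempty ground set axioms (C1)-(C3) of the paper. -/
structure BingoMatroid (α : Type*) [DecidableEq α] where
  /-- the ground set -/
  E : Finset α
  /-- the circuits (bingo cards) -/
  circuits : Finset (Finset α)
  subset_ground : ∀ C ∈ circuits, C ⊆ E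
  empty_not_mem : ∅ ∉ circuits
  antichain : ∀ C₁ ∈ circuits, ∀ C₂ ∈ circuits, C₁ ⊆ C₂ → C₁ = C₂
  elimination : ∀ C₁ ∈ circuits, ∀ C₂ ∈ circuits, C₁ ≠ C₂ →
    ∀ e ∈ C₁ ∩ C₂, ∃ C₃ ∈ circuits, C₃ ⊆ (C₁ ∪ C₂) \ {e}

/-- The completion time `t_C(σ)`: the least `t` such that every element of `C`
has been called out among the first `t` values of `σ`. -/
noncomputable def hitTime {α : Type*} {n : ℕ} (σ : Fin n → α) (C : Finset α) : ℕ :=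
  sInf {t : ℕ | ∀ x ∈ C, ∃ i : Fin n, (i : ℕ) < t ∧ σ i = x}

namespace BingoMatroid

variable {α : Type*} [DecidableEq α]

/-- `C` wins the bingo game under calling order `σ`: it is completed strictly
before every other circuit. -/
def Wins (M : BingoMatroid α) (σ : Fin M.E.card ≃ {x // x ∈ M.E}) (C : Finset α) : Prop :=
  ∀ C' ∈ M.circuits, C' ≠ C →
    hitTime (fun i => (σ i : α)) C < hitTime (fun i => (σ i : α)) C'

/-- The winning probability `β_C`: the number of calling orders under which `C`
wins, divided by `n!`. -/
noncomputable def beta (M : BingoMatroid α) (C : Finset α) : ℚ :=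
  (Nat.card {σ : Fin M.E.card ≃ {x // x ∈ M.E} // M.Wins σ C} : ℚ) /
    (Nat.factorial M.E.card : ℚ)

/-- The timed winning probability `β_C(t)`: the probability that `C` wins and is
completed exactly in round `t`. -/
noncomputable def betaT (M : BingoMatroid α) (C : Finset α) (t : ℕ) : ℚ :=
  (Nat.card {σ : Fin M.E.card ≃ {x // x ∈ M.E} //
      M.Wins σ C ∧ hitTime (fun i => (σ i : α)) C = t} : ℚ) /
    (Nat.factorial M.E.card : ℚ)

/-- A set is independent if it is contained in the ground set and contains no circuit. -/
def Indep (M : BingoMatroid α) (I : Finset α) : Prop :=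
  I ⊆ M.E ∧ ∀ C ∈ M.circuits, ¬ C ⊆ I

/-- The rank of the matroid: the maximum size of an independent set. -/
noncomputable def rank (M : BingoMatroid α) : ℕ :=
  sSup {k : ℕ | ∃ I : Finset α, M.Indep I ∧ I.card = k}

/-- A basis is a maximal independent set. -/
def IsBase (M : BingoMatroid α) (B : Finset α) : Prop :=
  M.Indep B ∧ ∀ J : Finset α, M.Indep J → B ⊆ J → B = J

/-- A coloop is an element of the ground set contained in no circuit. -/
def IsColoop (M : BingoMatroid α) (e : α) : Prop :=
  e ∈ M.E ∧ ∀ C ∈ M.circuits, e ∉ C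

/-- `D` is a circuit of the contraction `M/T`: a nonempty inclusion-minimal
member of `{C \ T : C a circuit of M}`. -/
def IsContractCircuit (M : BingoMatroid α) (T D : Finset α) : Prop :=
  D.Nonempty ∧ (∃ C ∈ M.circuits, D = C \ T) ∧
    ∀ C' ∈ M.circuits, (C' \ T).Nonempty → ¬ (C' \ T) ⊂ D

end BingoMatroid

namespace BingoMatroid

section Independence

variable {α : Type*} [DecidableEq α] (M : BingoMatroid α)

theorem Indep.mono {M : BingoMatroid α} {I J : Finset α} (hI : M.Indep I) (hJI : J ⊆ I) :
    M.Indep J :=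
  ⟨hJI.trans hI.1, fun D hD hDJ => hI.2 D hD (hDJ.trans hJI)⟩

theorem bddAbove_indep_card : BddAbove {k : ℕ | ∃ I : Finset α, M.Indep I ∧ I.card = k} :=
  ⟨M.E.card, by rintro k ⟨I, hI, rfl⟩; exact card_le_card hI.1⟩

theorem Indep.card_le_rank {M : BingoMatroid α} {I : Finset α} (hI : M.Indep I) :
    I.card ≤ M.rank :=
  le_csSup M.bddAbove_indep_card ⟨I, hI, rfl⟩

theorem indep_empty : M.Indep ∅ :=
  ⟨empty_subset _, fun _ hD hsub => M.empty_not_mem (subset_empty.1 hsub ▸ hD)⟩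

theorem exists_indep_card_eq_rank : ∃ I : Finset α, M.Indep I ∧ I.card = M.rank :=
  Nat.sSup_mem (s := {k : ℕ | ∃ I : Finset α, M.Indep I ∧ I.card = k})
    ⟨0, ∅, M.indep_empty, card_empty⟩ M.bddAbove_indep_card

theorem exists_circuit_subset_of_rank_lt {S : Finset α} (hS : S ⊆ M.E) (hr : M.rank < S.card) :
    ∃ D ∈ M.circuits, D ⊆ S := by
  by_contra! h
  exact absurd (Indep.card_le_rank (M := M) ⟨hS, h⟩) (by lia)

/-- Two circuits through `e` cannot both lie in `insert e I` with `I` independent. -/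
theorem Indep.circuit_unique {M : BingoMatroid α} {I : Finset α} (hI : M.Indep I) {e : α}
    {D₁ D₂ : Finset α} (h₁ : D₁ ∈ M.circuits) (h₂ : D₂ ∈ M.circuits)
    (hs₁ : D₁ ⊆ insert e I) (hs₂ : D₂ ⊆ insert e I) : D₁ = D₂ := by
  by_contra hne
  have mem : ∀ D ∈ M.circuits, D ⊆ insert e I → e ∈ D := fun D hD hs => by
    by_contra he
    exact hI.2 D hD ((subset_insert_iff_of_notMem he).1 hs)
  obtain ⟨D₃, h₃, hs₃⟩ := M.elimination D₁ h₁ D₂ h₂ hne e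
    (mem_inter.2 ⟨mem D₁ h₁ hs₁, mem D₂ h₂ hs₂⟩)
  refine hI.2 D₃ h₃ fun x hx => ?_
  have := hs₃ hx
  grind

/-- Every independent set extends to an independent set of maximum size. -/
theorem Indep.exists_superset_card_eq_rank {M : BingoMatroid α} {J : Finset α}
    (hJ : M.Indep J) : ∃ I : Finset α, J ⊆ I ∧ M.Indep I ∧ I.card = M.rank := by
  classical
  obtain ⟨I, hI, hmin⟩ := exists_min_image
    (M.E.powerset.filter fun I => M.Indep I ∧ I.card = M.rank) (fun I => (J \ I).card) <| by
      obtain ⟨I, hI, hc⟩ := M.exists_indep_card_eq_rank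
      exact ⟨I, by simp [hI, hc, hI.1]⟩
  simp only [mem_filter, mem_powerset, and_imp] at hI hmin
  obtain ⟨hIE, hind, hcard⟩ := hI
  refine ⟨I, ?_, hind, hcard⟩
  by_contra hJI
  obtain ⟨e, heJ, heI⟩ := not_subset.1 hJI
  have key : ∀ f ∈ I \ J, ∃ D ∈ M.circuits, D ⊆ insert e (I.erase f) := fun f hf => by
    obtain ⟨hfI, hfJ⟩ := mem_sdiff.1 hf
    have hsub : insert e (I.erase f) ⊆ M.E :=
      insert_subset (hJ.1 heJ) ((erase_subset _ _).trans hIE)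
    by_contra! hcon
    have hc : (insert e (I.erase f)).card = M.rank := by
      rw [card_insert_of_notMem (by simp [heI]), card_erase_add_one hfI, hcard]
    have hle := hmin _ hsub ⟨hsub, hcon⟩ hc
    have hlt : (J \ insert e (I.erase f)).card < (J \ I).card := by
      refine card_lt_card ⟨fun x hx => ?_, fun h => ?_⟩
      · grind
      · have := h (mem_sdiff.2 ⟨heJ, heI⟩)
        simp at this
    lia
  have hIJ : (I \ J).Nonempty := by
    rw [sdiff_nonempty]
    intro h
    exact hJI (eq_of_subset_of_card_le h (hcard ▸ hJ.card_le_rank)).symm.subset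
  obtain ⟨g, hg⟩ := hIJ
  obtain ⟨D, hD, hDs⟩ := key g hg
  obtain ⟨h, hhD, hhJ⟩ := not_subset.1 (hJ.2 D hD)
  have hhI : h ∈ I \ J := by have := hDs hhD; grind
  obtain ⟨D', hD', hDs'⟩ := key h hhI
  have heq := hind.circuit_unique hD hD' (hDs.trans (insert_subset_insert _ (erase_subset _ _)))
    (hDs'.trans (insert_subset_insert _ (erase_subset _ _)))
  have := hDs' (heq ▸ hhD)
  grind

/-- Every circuit is the only circuit of some set of size `r + 1`. -/
theorem exists_superset_unique_circuit {C : Finset α} (hC : C ∈ M.circuits) :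
    ∃ S ⊆ M.E, C ⊆ S ∧ S.card = M.rank + 1 ∧ ∀ D ∈ M.circuits, D ⊆ S → D = C := by
  obtain ⟨e, he⟩ : C.Nonempty := nonempty_iff_ne_empty.2 fun h => M.empty_not_mem (h ▸ hC)
  have hJ : M.Indep (C.erase e) :=
    ⟨(erase_subset _ _).trans (M.subset_ground C hC), fun D hD hs => by
      have := M.antichain D hD C hC (hs.trans (erase_subset _ _))
      exact notMem_erase e C (hs (this ▸ he))⟩
  obtain ⟨I, hJI, hI, hcard⟩ := hJ.exists_superset_card_eq_rank
  have hCI : C ⊆ insert e I := by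
    rw [← insert_erase he]; exact insert_subset_insert _ hJI
  have heI : e ∉ I := fun h => hI.2 C hC (by rwa [insert_eq_of_mem h] at hCI)
  exact ⟨insert e I, insert_subset (M.subset_ground C hC he) hI.1, hCI,
    by rw [card_insert_of_notMem heI, hcard], fun D hD hs => hI.circuit_unique hD hC hs hCI⟩

end Independence

section Orders

variable {α : Type*} [DecidableEq α] {E : Finset α}

/-- The set of elements called in the first `t` rounds. -/
def called (σ : Fin E.card ≃ {x // x ∈ E}) (t : ℕ) : Finset α :=
  (univ.filter fun i : Fin E.card => (i : ℕ) < t).image fun i => (σ i : α)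

theorem mem_called {σ : Fin E.card ≃ {x // x ∈ E}} {t : ℕ} {x : α} :
    x ∈ called σ t ↔ ∃ i : Fin E.card, (i : ℕ) < t ∧ (σ i : α) = x := by
  simp [called]

theorem called_subset (σ : Fin E.card ≃ {x // x ∈ E}) (t : ℕ) : called σ t ⊆ E := fun x hx => by
  obtain ⟨i, -, rfl⟩ := mem_called.1 hx
  exact (σ i).2

theorem called_mono (σ : Fin E.card ≃ {x // x ∈ E}) {s t : ℕ} (hst : s ≤ t) :
    called σ s ⊆ called σ t := fun x hx => by
  obtain ⟨i, hi, rfl⟩ := mem_called.1 hx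
  exact mem_called.2 ⟨i, hi.trans_le hst, rfl⟩

theorem card_called (σ : Fin E.card ≃ {x // x ∈ E}) {t : ℕ} (ht : t ≤ E.card) :
    (called σ t).card = t := by
  have hinj : Function.Injective fun i => (σ i : α) := Subtype.val_injective.comp σ.injective
  rw [called, card_image_of_injective _ hinj, Fin.card_filter_val_lt]
  exact min_eq_right ht

theorem mem_called_apply {σ : Fin E.card ≃ {x // x ∈ E}} {t : ℕ} {i : Fin E.card} :
    (σ i : α) ∈ called σ t ↔ (i : ℕ) < t := by
  rw [mem_called]
  refine ⟨?_, fun h => ⟨i, h, rfl⟩⟩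
  rintro ⟨j, hj, h⟩
  rwa [← σ.injective (Subtype.ext h)]

theorem hitTime_le_iff {σ : Fin E.card ≃ {x // x ∈ E}} {D : Finset α} (hD : D ⊆ E) {t : ℕ} :
    hitTime (fun i => (σ i : α)) D ≤ t ↔ D ⊆ called σ t := by
  constructor
  · intro h
    have hne : {t : ℕ | ∀ x ∈ D, ∃ i : Fin E.card, (i : ℕ) < t ∧ (σ i : α) = x}.Nonempty :=
      ⟨E.card, fun x hx => ⟨σ.symm ⟨x, hD hx⟩, Fin.is_lt _, by simp⟩⟩
    have hmem := Nat.sInf_mem hne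
    exact fun x hx => called_mono σ h (mem_called.2 (hmem x hx))
  · exact fun h => Nat.sInf_le fun x hx => mem_called.1 (h hx)

/-- Subsets of `E` of the same size are related by a permutation of `E`. -/
theorem exists_perm_mem_iff {A B : Finset α} (hA : A ⊆ E) (hB : B ⊆ E) (h : A.card = B.card) :
    ∃ π : Equiv.Perm {x // x ∈ E}, ∀ x, (π x : α) ∈ B ↔ (x : α) ∈ A := by
  have card_eq : ∀ A ⊆ E, Fintype.card {x : {x // x ∈ E} // (x : α) ∈ A} = A.card := fun A hA => by
    rw [Fintype.card_subtype, ← card_map (Function.Embedding.subtype _)]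
    congr 1
    ext x
    simpa using fun hx => hA hx
  let e : {x : {x // x ∈ E} // (x : α) ∈ A} ≃ {x : {x // x ∈ E} // (x : α) ∈ B} :=
    Fintype.equivOfCardEq (by rw [card_eq A hA, card_eq B hB, h])
  refine ⟨e.extendSubtype, fun x => ⟨fun hx => ?_, fun hx => e.extendSubtype_mem x hx⟩⟩
  by_contra hxA
  exact e.extendSubtype_not_mem x hxA hx

theorem called_trans {A B : Finset α} (hB : B ⊆ E) {π : Equiv.Perm {x // x ∈ E}}
    (hπ : ∀ x, (π x : α) ∈ B ↔ (x : α) ∈ A) {σ : Fin E.card ≃ {x // x ∈ E}} {t : ℕ}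
    (hσ : called σ t = A) : called (σ.trans π) t = B := by
  subst hσ
  ext x
  by_cases hx : x ∈ E
  · obtain ⟨i, hi⟩ := (σ.trans π).surjective ⟨x, hx⟩
    obtain rfl : ((σ.trans π) i : α) = x := congrArg Subtype.val hi
    rw [mem_called_apply, Equiv.trans_apply, hπ, mem_called_apply]
  · exact ⟨fun h => absurd (called_subset _ _ h) hx, fun h => absurd (hB h) hx⟩

theorem exists_called_eq {A : Finset α} (hA : A ⊆ E) {x : α} (hx : x ∈ E) (hxA : x ∉ A) :
    ∃ σ : Fin E.card ≃ {x // x ∈ E}, called σ A.card = A ∧ x ∈ called σ (A.card + 1) := by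
  have hcard := card_le_card hA
  obtain ⟨π, hπ⟩ := exists_perm_mem_iff (called_subset E.equivFin.symm A.card) hA
    (card_called _ hcard)
  have hτ : called (E.equivFin.symm.trans π) A.card = A := called_trans hA hπ rfl
  set τ := E.equivFin.symm.trans π
  obtain ⟨j, hj⟩ := τ.surjective ⟨x, hx⟩
  have hjA : ¬ (j : ℕ) < A.card := fun h => hxA <| by
    rw [← mem_called_apply (σ := τ), hτ, hj] at h
    exact h
  let k : Fin E.card := ⟨A.card, (not_lt.1 hjA).trans_lt j.2⟩
  refine ⟨(Equiv.swap k j).trans τ, ?_, ?_⟩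
  · refine eq_of_subset_of_card_le (fun y hy => ?_) (card_called _ hcard).ge
    obtain ⟨i, hi, rfl⟩ := mem_called.1 hy
    have hik : i ≠ k := fun h => by simp [h, k] at hi
    have hij : i ≠ j := fun h => hjA (h ▸ hi)
    rw [Equiv.trans_apply, Equiv.swap_apply_of_ne_of_ne hik hij, ← hτ]
    exact mem_called_apply.2 hi
  · exact mem_called.2 ⟨k, Nat.lt_succ_self _, by simp [hj]⟩

end Orders

section Winning

variable {α : Type*} [DecidableEq α] (M : BingoMatroid α)

theorem wins_of_called {C : Finset α} (hC : C ∈ M.circuits)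
    {σ : Fin M.E.card ≃ {x // x ∈ M.E}} {t : ℕ} (hs : C ⊆ called σ t)
    (huniq : ∀ D ∈ M.circuits, D ⊆ called σ t → D = C) : M.Wins σ C := fun D hD hne => by
  refine ((hitTime_le_iff (M.subset_ground C hC)).2 hs).trans_lt (not_le.1 fun h => ?_)
  exact hne (huniq D hD ((hitTime_le_iff (M.subset_ground D hD)).1 h))

theorem Wins.called_eq {M : BingoMatroid α} {C : Finset α} (hC : C ∈ M.circuits)
    (hcard : C.card = M.rank + 1) {σ : Fin M.E.card ≃ {x // x ∈ M.E}} (hσ : M.Wins σ C) :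
    called σ (M.rank + 1) = C := by
  have hE := M.subset_ground C hC
  have hc : (called σ (M.rank + 1)).card = M.rank + 1 :=
    card_called σ (hcard ▸ card_le_card hE)
  obtain ⟨D, hD, hs⟩ := M.exists_circuit_subset_of_rank_lt (called_subset σ (M.rank + 1))
    (by lia)
  have hCs : C ⊆ called σ (M.rank + 1) := by
    by_cases hDC : D = C
    · exact hDC ▸ hs
    · exact (hitTime_le_iff hE).1
        ((hσ D hD hDC).le.trans ((hitTime_le_iff (M.subset_ground D hD)).2 hs))
  exact (eq_of_subset_of_card_le hCs (by lia)).symm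

/-- Orders in which a circuit `C` of maximum size wins can be injected into those in which `C'`
wins, so that the first `r + 1` elements called become a fixed superset of `C'` whose only
circuit is `C'`. -/
theorem exists_injective_wins {C C' : Finset α} (hC : C ∈ M.circuits) (hC' : C' ∈ M.circuits)
    (hcard : C.card = M.rank + 1) :
    ∃ S : Finset α, C' ⊆ S ∧ (∀ D ∈ M.circuits, D ⊆ S → D = C') ∧
      ∃ f : {σ // M.Wins σ C} → {σ // M.Wins σ C'},
        f.Injective ∧ ∀ σ, called (f σ).1 (M.rank + 1) = S := by
  obtain ⟨S, hSE, hCS, hScard, hS⟩ := M.exists_superset_unique_circuit hC'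
  obtain ⟨π, hπ⟩ := exists_perm_mem_iff (M.subset_ground C hC) hSE (hcard.trans hScard.symm)
  have hcalled : ∀ σ, M.Wins σ C → called (σ.trans π) (M.rank + 1) = S := fun σ hσ =>
    called_trans hSE hπ (hσ.called_eq hC hcard)
  refine ⟨S, hCS, hS, Subtype.map (fun σ => σ.trans π) fun σ hσ => ?_,
    Subtype.map_injective _ fun σ τ h => ?_, fun σ => hcalled σ.1 σ.2⟩
  · have h := hcalled σ hσ
    exact M.wins_of_called hC' (hCS.trans h.superset) (h ▸ hS)
  · exact Equiv.ext fun i => π.injective (DFunLike.congr_fun h i)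

/-- A circuit of maximum size never has a larger winning probability than another circuit. -/
theorem beta_le_beta {C C' : Finset α} (hC : C ∈ M.circuits) (hC' : C' ∈ M.circuits)
    (hcard : C.card = M.rank + 1) : M.beta C ≤ M.beta C' := by
  obtain ⟨-, -, -, f, hf, -⟩ := M.exists_injective_wins hC hC' hcard
  unfold beta
  gcongr
  exact Nat.card_le_card_of_injective f hf

/-- A circuit of maximum size is strictly less likely to win than any smaller circuit. -/
theorem beta_lt_beta {C C' : Finset α} (hC : C ∈ M.circuits) (hC' : C' ∈ M.circuits)
    (hcard : C.card = M.rank + 1) (hlt : C'.card < C.card) : M.beta C < M.beta C' := by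
  classical
  obtain ⟨S, hCS, hS, f, hf, hfS⟩ := M.exists_injective_wins hC hC' hcard
  have hnsub : ¬ C ⊆ S := fun h => hlt.ne' (congrArg card (hS C hC h))
  obtain ⟨x, hxC, hxS⟩ := not_subset.1 hnsub
  obtain ⟨σ, hσ, hxσ⟩ := exists_called_eq (M.subset_ground C' hC') (M.subset_ground C hC hxC)
    fun h => hxS (hCS h)
  have hwins : M.Wins σ C' := M.wins_of_called hC' hσ.superset fun D hD hs =>
    M.antichain D hD C' hC' (hσ ▸ hs)
  have hnot : (⟨σ, hwins⟩ : {σ // M.Wins σ C'}) ∉ Set.range f := by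
    rintro ⟨τ, hτ⟩
    have h := hfS τ
    rw [hτ] at h
    exact hxS (h ▸ called_mono σ (by lia) hxσ)
  unfold beta
  gcongr
  rw [Nat.card_eq_fintype_card, Nat.card_eq_fintype_card]
  exact Fintype.card_lt_of_injective_of_notMem f hf hnot

end Winning

end BingoMatroid

/-- no monotonicity violation involving a circuit of maximum size
`r + 1`: `β_C ≤ β_{C'}`, with equality iff `d = 0`. -/
theorem stmt9 {α : Type*} [DecidableEq α] (M : BingoMatroid α) (hE : M.E.Nonempty)
    (C C' : Finset α) (hC : C ∈ M.circuits) (hC' : C' ∈ M.circuits) (hne : C ≠ C')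
    (d : ℕ) (h1 : C.card = M.rank + 1) (h2 : C'.card = M.rank + 1 - d)
    (hd : d < M.rank + 1) :
    M.beta C ≤ M.beta C' ∧ (M.beta C = M.beta C' ↔ d = 0) := by
  refine ⟨M.beta_le_beta hC hC' h1, fun h => ?_, fun h => ?_⟩
  · by_contra hd0
    exact (M.beta_lt_beta hC hC' h1 (by lia)).ne h
  · exact (M.beta_le_beta hC hC' h1).antisymm (M.beta_le_beta hC' hC (by lia))
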